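/- Let I be a primitive rank-2 isotropic sublattice of the K3 lattice Λ_K3. Then the quotient lattice I^⊥/I, equipped with the symmetric bilinear form induced from Λ_K3, is isometric to H ⊕ E₈ ⊕ E₈. -/

import Mathlib

/- Background definitions: integral lattices, the hyperbolic plane `H`, the
   `E₈` lattice, the K3 lattice `Λ_K3 = H ⊕ H ⊕ H ⊕ E₈ ⊕ E₈`, primitivity,
   isotropy, and (doubly) admissible classes. -/

namespace DF

/-- Integer bilinear form on a `ℤ`-module. -/
abbrev Bil (G : Type) [AddCommGroup G] := G →ₗ[ℤ] G →ₗ[ℤ] ℤ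

section Defs

variable {G G' : Type} [AddCommGroup G] [AddCommGroup G']

/-- A primitive element of a free `ℤ`-module. -/
def PrimElt (p : G) : Prop := ∀ (n : ℤ) (x : G), p = n • x → IsUnit n

/-- A primitive subgroup (torsion-free quotient). -/
def PrimSub (S : Submodule ℤ G) : Prop :=
  ∀ (n : ℤ) (x : G), n ≠ 0 → n • x ∈ S → x ∈ S

/-- `S` is a primitive subgroup of `T` (i.e. `T/S` is torsion-free). -/
def PrimIn (S T : Submodule ℤ G) : Prop :=
  ∀ (n : ℤ) (x : G), n ≠ 0 → x ∈ T → n • x ∈ S → x ∈ S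

/-- `e` is a primitive element of the subgroup `S`. -/
def PrimEltIn (S : Submodule ℤ G) (e : G) : Prop :=
  ∀ (n : ℤ) (x : G), x ∈ S → e = n • x → IsUnit n

/-- The bilinear form vanishes identically on `S`. -/
def IsotropicSub (B : Bil G) (S : Submodule ℤ G) : Prop :=
  ∀ x ∈ S, ∀ y ∈ S, B x y = 0

/-- The restriction of `B` to `S` is nondegenerate. -/
def NondegOn (B : Bil G) (S : Submodule ℤ G) : Prop :=
  ∀ x ∈ S, (∀ y ∈ S, B x y = 0) → x = 0

/-- The (two-sided) orthogonal complement of a submodule. -/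
def perpSub (B : Bil G) (S : Submodule ℤ G) : Submodule ℤ G where
  carrier := {v | ∀ s ∈ S, B s v = 0 ∧ B v s = 0}
  zero_mem' := by intro s hs; simp
  add_mem' := by
    intro x y hx hy s hs
    obtain ⟨h1, h2⟩ := hx s hs; obtain ⟨h3, h4⟩ := hy s hs
    constructor <;> simp [map_add, LinearMap.add_apply, h1, h2, h3, h4]
  smul_mem' := by
    intro c x hx s hs
    obtain ⟨h1, h2⟩ := hx s hs
    constructor <;> simp [map_smul, LinearMap.smul_apply, smul_eq_mul, h1, h2]

/-- The submodule `N` of `(G, B)` is isometric to the lattice `(G', B')`. -/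
def IsometricTo (B : Bil G) (N : Submodule ℤ G) (B' : Bil G') : Prop :=
  ∃ e : G' ≃ₗ[ℤ] ↥N, ∀ u v : G', B ((e u : ↥N) : G) ((e v : ↥N) : G) = B' u v

/-- `div(e) = m` in `S`: the image of `⟨e, -⟩ : S → ℤ` is generated by `m`. -/
def DivEq (B : Bil G) (S : Submodule ℤ G) (e : G) (m : ℤ) : Prop :=
  (∀ x ∈ S, m ∣ B e x) ∧ ∃ x ∈ S, B e x = m

/-- `e` is an `m`-admissible class of the (nondegenerate) lattice `S`:
    `e ∈ S` is primitive isotropic with `div(e) = m`, and there is an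
    isotropic `g ∈ S` with `div(g) = m` and `⟨e, g⟩ = m`. -/
def MAdm (B : Bil G) (S : Submodule ℤ G) (e : G) (m : ℤ) : Prop :=
  e ∈ S ∧ PrimEltIn S e ∧ B e e = 0 ∧ DivEq B S e m ∧
  ∃ g ∈ S, B g g = 0 ∧ DivEq B S g m ∧ B e g = m

/-- The rank-two isotropic sublattice `I` of `S` is doubly admissible in `S`:
    there are primitive generators `e₁, e₂` of `I` and isotropic classes
    `g₁, g₂ ∈ S` with `⟨e₁,g₁⟩ = ⟨e₂,g₂⟩ = 1` and `⟨e₁,g₂⟩ = ⟨e₂,g₁⟩ = 0`. -/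
def DoublyAdm (B : Bil G) (S : Submodule ℤ G) (I : Submodule ℤ G) : Prop :=
  ∃ e₁ e₂ g₁ g₂ : G, e₁ ∈ S ∧ e₂ ∈ S ∧ g₁ ∈ S ∧ g₂ ∈ S ∧
    PrimEltIn S e₁ ∧ PrimEltIn S e₂ ∧ I = Submodule.span ℤ {e₁, e₂} ∧
    B g₁ g₁ = 0 ∧ B g₂ g₂ = 0 ∧
    B e₁ g₁ = 1 ∧ B e₂ g₂ = 1 ∧ B e₁ g₂ = 0 ∧ B e₂ g₁ = 0

/-- Signature `(1, rank - 1)` for the sublattice `L`: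
    there is a rationally spanning pairwise orthogonal family in `L` with one
    vector of positive square and `rank L - 1` of negative square. -/
def SigOneRest (B : Bil G) (L : Submodule ℤ G) : Prop :=
  1 ≤ Module.finrank ℤ ↥L ∧
  ∃ (v₀ : G) (w : Fin (Module.finrank ℤ ↥L - 1) → G),
    v₀ ∈ L ∧ (∀ i, w i ∈ L) ∧ 0 < B v₀ v₀ ∧ (∀ i, B (w i) (w i) < 0) ∧
    (∀ i, B v₀ (w i) = 0) ∧ (∀ i j, i ≠ j → B (w i) (w j) = 0) ∧
    ∀ u ∈ L, ∃ m : ℤ, m ≠ 0 ∧ m • u ∈ Submodule.span ℤ (insert v₀ (Set.range w))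

end Defs

section Lattices

variable {G₁ G₂ : Type} [AddCommGroup G₁] [AddCommGroup G₂]

/-- The orthogonal direct sum of two bilinear forms. -/
def prodForm (B₁ : Bil G₁) (B₂ : Bil G₂) : Bil (G₁ × G₂) :=
  LinearMap.mk₂ ℤ (fun u v => B₁ u.1 v.1 + B₂ u.2 v.2)
    (by intro m₁ m₂ n; simp [map_add, LinearMap.add_apply]; ring)
    (by intro c m n; simp [map_smul, LinearMap.smul_apply, smul_eq_mul]; ring)
    (by intro m n₁ n₂; simp [map_add, LinearMap.add_apply]; ring)
    (by intro c m n; simp [map_smul, LinearMap.smul_apply, smul_eq_mul]; ring)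

/-- The hyperbolic plane `H`: `ℤ²` with Gram matrix `!![0, 1; 1, 0]`. -/
def HForm : Bil (Fin 2 → ℤ) :=
  LinearMap.mk₂ ℤ (fun x y => x 0 * y 1 + x 1 * y 0)
    (by intro m₁ m₂ n; simp [Pi.add_apply]; ring)
    (by intro c m n; simp [Pi.smul_apply, smul_eq_mul]; ring)
    (by intro m n₁ n₂; simp [Pi.add_apply]; ring)
    (by intro c m n; simp [Pi.smul_apply, smul_eq_mul]; ring)

/-- The negative of the `E₈` Cartan matrix (Bourbaki numbering). -/
def E8Gram : Matrix (Fin 8) (Fin 8) ℤ :=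
  !![-2,  0,  1,  0,  0,  0,  0,  0;
      0, -2,  0,  1,  0,  0,  0,  0;
      1,  0, -2,  1,  0,  0,  0,  0;
      0,  1,  1, -2,  1,  0,  0,  0;
      0,  0,  0,  1, -2,  1,  0,  0;
      0,  0,  0,  0,  1, -2,  1,  0;
      0,  0,  0,  0,  0,  1, -2,  1;
      0,  0,  0,  0,  0,  0,  1, -2]

/-- The negative definite even unimodular root lattice `E₈`. -/
def E8Form : Bil (Fin 8 → ℤ) := Matrix.toLinearMap₂' ℤ E8Gram

/-- The underlying group of `H ⊕ H`. -/
abbrev HHtype := (Fin 2 → ℤ) × (Fin 2 → ℤ)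

/-- The lattice `H ⊕ H`. -/
def HHForm : Bil HHtype := prodForm HForm HForm

/-- The underlying group of `H ⊕ E₈ ⊕ E₈`. -/
abbrev HEEtype := (Fin 2 → ℤ) × (Fin 8 → ℤ) × (Fin 8 → ℤ)

/-- The lattice `H ⊕ E₈ ⊕ E₈`. -/
def HEEForm : Bil HEEtype := prodForm HForm (prodForm E8Form E8Form)

/-- The underlying group of the K3 lattice `Λ_K3 = H ⊕ H ⊕ H ⊕ E₈ ⊕ E₈`. -/
abbrev K3type := (Fin 2 → ℤ) × (Fin 2 → ℤ) × (Fin 2 → ℤ) × (Fin 8 → ℤ) × (Fin 8 → ℤ)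

/-- The K3 lattice `Λ_K3 = H ⊕ H ⊕ H ⊕ E₈ ⊕ E₈`. -/
def K3Form : Bil K3type :=
  prodForm HForm (prodForm HForm (prodForm HForm (prodForm E8Form E8Form)))

end Lattices

end DF

namespace DF

section Isometries

variable {G G₁ G₂ : Type} [AddCommGroup G] [AddCommGroup G₁] [AddCommGroup G₂]

@[simp]
theorem prodForm_apply (B₁ : Bil G₁) (B₂ : Bil G₂) (u v : G₁ × G₂) :
    prodForm B₁ B₂ u v = B₁ u.1 v.1 + B₂ u.2 v.2 := rfl

@[simp]
theorem HForm_apply (x y : Fin 2 → ℤ) : HForm x y = x 0 * y 1 + x 1 * y 0 := rfl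

/-- Symmetry of a bilinear form. -/
def IsSymmForm (B : Bil G) : Prop := ∀ x y, B x y = B y x

/-- A form all of whose squares are even. -/
def IsEvenForm (B : Bil G) : Prop := ∀ x, ∃ q, B x x = 2 * q

/-- Divisibility form of unimodularity: an integer dividing all products with `v` divides `v`. -/
def IsUnimodularForm (B : Bil G) : Prop :=
  ∀ (d : ℤ) (v : G), (∀ w, d ∣ B v w) → ∃ u, v = d • u

theorem IsSymmForm.prod {B₁ : Bil G₁} {B₂ : Bil G₂} (h₁ : IsSymmForm B₁) (h₂ : IsSymmForm B₂) :
    IsSymmForm (prodForm B₁ B₂) := fun x y => by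
  rw [prodForm_apply, prodForm_apply, h₁, h₂]

theorem IsEvenForm.prod {B₁ : Bil G₁} {B₂ : Bil G₂} (h₁ : IsEvenForm B₁) (h₂ : IsEvenForm B₂) :
    IsEvenForm (prodForm B₁ B₂) := fun x => by
  obtain ⟨q₁, hq₁⟩ := h₁ x.1
  obtain ⟨q₂, hq₂⟩ := h₂ x.2
  exact ⟨q₁ + q₂, by rw [prodForm_apply, hq₁, hq₂]; ring⟩

theorem IsUnimodularForm.prod {B₁ : Bil G₁} {B₂ : Bil G₂} (h₁ : IsUnimodularForm B₁)
    (h₂ : IsUnimodularForm B₂) : IsUnimodularForm (prodForm B₁ B₂) := fun d v h => by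
  obtain ⟨u₁, hu₁⟩ := h₁ d v.1 fun w => by simpa using h (w, 0)
  obtain ⟨u₂, hu₂⟩ := h₂ d v.2 fun w => by simpa using h (0, w)
  exact ⟨(u₁, u₂), Prod.ext hu₁ hu₂⟩

theorem HForm_symm : IsSymmForm HForm := fun x y => by
  simp only [HForm_apply]; ring

theorem HForm_even : IsEvenForm HForm := fun x =>
  ⟨x 0 * x 1, by simp only [HForm_apply]; ring⟩

theorem HForm_unimodular : IsUnimodularForm HForm := fun d v h => by
  obtain ⟨s, hs⟩ : d ∣ v 0 := by simpa using h ![0, 1]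
  obtain ⟨t, ht⟩ : d ∣ v 1 := by simpa using h ![1, 0]
  exact ⟨![s, t], by ext i; fin_cases i <;> simp [hs, ht]⟩

theorem E8Form_apply (x y : Fin 8 → ℤ) : E8Form x y = x ⬝ᵥ E8Gram.mulVec y := by
  simp only [E8Form, Matrix.toLinearMap₂'_apply']

theorem E8Form_symm : IsSymmForm E8Form := fun x y => by
  have h : E8Gram.transpose = E8Gram := by decide
  rw [E8Form_apply, E8Form_apply, Matrix.dotProduct_mulVec, ← Matrix.mulVec_transpose, h,
    dotProduct_comm]

theorem E8Form_even : IsEvenForm E8Form := fun x =>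
  ⟨-(x 0 ^ 2 + x 1 ^ 2 + x 2 ^ 2 + x 3 ^ 2 + x 4 ^ 2 + x 5 ^ 2 + x 6 ^ 2 + x 7 ^ 2)
    + (x 0 * x 2 + x 1 * x 3 + x 2 * x 3 + x 3 * x 4 + x 4 * x 5 + x 5 * x 6 + x 6 * x 7), by
    rw [E8Form_apply]
    simp [E8Gram, Matrix.mulVec, dotProduct, Fin.sum_univ_succ, Fin.succ]
    ring⟩

/-- The inverse of `E8Gram`. -/
def E8GramInv : Matrix (Fin 8) (Fin 8) ℤ :=
  !![-4, -5, -7, -10, -8, -6, -4, -2;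
     -5, -8, -10, -15, -12, -9, -6, -3;
     -7, -10, -14, -20, -16, -12, -8, -4;
     -10, -15, -20, -30, -24, -18, -12, -6;
     -8, -12, -16, -24, -20, -15, -10, -5;
     -6, -9, -12, -18, -15, -12, -8, -4;
     -4, -6, -8, -12, -10, -8, -6, -3;
     -2, -3, -4, -6, -5, -4, -3, -2]

theorem E8Form_unimodular : IsUnimodularForm E8Form := fun d v h => by
  have hinv : E8Gram * E8GramInv = 1 := by decide
  have hv : ∀ i, d ∣ v i := fun i => by
    have := h (E8GramInv.mulVec (Pi.single i 1))
    rwa [E8Form_apply, Matrix.mulVec_mulVec, hinv, Matrix.one_mulVec, dotProduct_single,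
      mul_one] at this
  choose u hu using hv
  exact ⟨u, funext hu⟩

theorem IsUnimodularForm.exists_eq_one {B : Bil G} (hB : IsUnimodularForm B) {v : G}
    (hv : PrimElt v) : ∃ w, B v w = 1 := by
  obtain ⟨d, hd⟩ := (IsPrincipalIdealRing.principal (LinearMap.range (B v))).principal
  have hdvd : ∀ w, d ∣ B v w := fun w => by
    have : B v w ∈ Submodule.span ℤ {d} := hd ▸ LinearMap.mem_range_self (B v) w
    exact Ideal.mem_span_singleton.mp this
  obtain ⟨u, hu⟩ := hB d v hdvd
  have h1 : (1 : ℤ) ∈ LinearMap.range (B v) := by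
    rw [hd]
    exact Ideal.mem_span_singleton.mpr (hv d u hu).dvd
  exact h1

/-- `v` and `w` lie in the same orbit of the isometry group of `B`. -/
def SameOrbit (B : Bil G) (v w : G) : Prop :=
  ∃ φ : G ≃ₗ[ℤ] G, (∀ x y, B (φ x) (φ y) = B x y) ∧ φ v = w

theorem SameOrbit.refl (B : Bil G) (v : G) : SameOrbit B v v :=
  ⟨LinearEquiv.refl ℤ G, fun _ _ => rfl, rfl⟩

theorem SameOrbit.trans {B : Bil G} {u v w : G} (h₁ : SameOrbit B u v) (h₂ : SameOrbit B v w) :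
    SameOrbit B u w := by
  obtain ⟨φ, hφ, rfl⟩ := h₁
  obtain ⟨ψ, hψ, rfl⟩ := h₂
  exact ⟨φ.trans ψ, fun x y => (hψ _ _).trans (hφ _ _), rfl⟩

theorem SameOrbit.neg (B : Bil G) (v : G) : SameOrbit B v (-v) :=
  ⟨LinearEquiv.neg ℤ, fun x y => by simp, rfl⟩

/-- The Eichler transvection attached to an isotropic vector `e` and a vector `x` orthogonal to `e`
with `B x x = 2 * q`, as a linear map. -/
def transvection (B : Bil G) (e x : G) (q : ℤ) : G →ₗ[ℤ] G :=
  LinearMap.id - (B x).smulRight e + (B e).smulRight x - (q • B e).smulRight e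

theorem transvection_apply (B : Bil G) (e x : G) (q : ℤ) (w : G) :
    transvection B e x q w = w - B x w • e + B e w • x - (q * B e w) • e := rfl

theorem transvection_neg_comp {B : Bil G} {e x : G} {q : ℤ} (hB : IsSymmForm B)
    (he : B e e = 0) (hex : B e x = 0) (hx : B x x = 2 * q) (w : G) :
    transvection B e (-x) q (transvection B e x q w) = w := by
  have hxe : B x e = 0 := by rw [hB, hex]
  simp only [transvection_apply, map_add, map_sub, map_neg, map_smul, LinearMap.neg_apply,
    he, hex, hx, hxe]
  module

theorem transvection_isometry {B : Bil G} {e x : G} {q : ℤ} (hB : IsSymmForm B)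
    (he : B e e = 0) (hex : B e x = 0) (hx : B x x = 2 * q) (v w : G) :
    B (transvection B e x q v) (transvection B e x q w) = B v w := by
  have hxe : B x e = 0 := by rw [hB, hex]
  simp only [transvection_apply, map_add, map_sub, map_smul, LinearMap.add_apply,
    LinearMap.sub_apply, LinearMap.smul_apply, smul_eq_mul, he, hex, hx, hxe, hB v e, hB v x]
  ring

theorem SameOrbit.transvection {B : Bil G} {e x : G} {q : ℤ} (hB : IsSymmForm B)
    (he : B e e = 0) (hex : B e x = 0) (hx : B x x = 2 * q) (v : G) :
    SameOrbit B v (transvection B e x q v) := by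
  refine ⟨LinearEquiv.ofLinearMap (DF.transvection B e x q) (DF.transvection B e (-x) q) ?_ ?_,
    transvection_isometry hB he hex hx, rfl⟩
  · refine LinearMap.ext fun w => ?_
    simpa using transvection_neg_comp (x := -x) (q := q) hB he (by simpa using hex)
      (by simpa using hx) w
  · exact LinearMap.ext (transvection_neg_comp hB he hex hx)

end Isometries

section Eichler

variable {M : Type} [AddCommGroup M]

/-- The orthogonal sum of two hyperbolic planes and `B`. -/
abbrev addTwoPlanes (B : Bil M) : Bil ((Fin 2 → ℤ) × (Fin 2 → ℤ) × M) :=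
  prodForm HForm (prodForm HForm B)

theorem addTwoPlanes_symm {B : Bil M} (hB : IsSymmForm B) : IsSymmForm (addTwoPlanes B) :=
  HForm_symm.prod (HForm_symm.prod hB)

theorem sameOrbit_e₁_e₂ {B : Bil M} (hB : IsSymmForm B) (t a b c d : ℤ) (m : M) :
    SameOrbit (addTwoPlanes B) (![a, b], ![c, d], m) (![a - t * d, b], ![c + t * b, d], m) := by
  convert SameOrbit.transvection (e := (![1, 0], 0, 0)) (x := (0, ![t, 0], 0)) (q := 0)
    (addTwoPlanes_symm hB) (by simp) (by simp) (by simp) (![a, b], ![c, d], m) using 1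
  simp [transvection_apply, mul_comm]

theorem sameOrbit_e₁_f₂ {B : Bil M} (hB : IsSymmForm B) (t a b c d : ℤ) (m : M) :
    SameOrbit (addTwoPlanes B) (![a, b], ![c, d], m) (![a - t * c, b], ![c, d + t * b], m) := by
  convert SameOrbit.transvection (e := (![1, 0], 0, 0)) (x := (0, ![0, t], 0)) (q := 0)
    (addTwoPlanes_symm hB) (by simp) (by simp) (by simp) (![a, b], ![c, d], m) using 1
  simp [transvection_apply, mul_comm]

theorem sameOrbit_f₁_e₂ {B : Bil M} (hB : IsSymmForm B) (t a b c d : ℤ) (m : M) :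
    SameOrbit (addTwoPlanes B) (![a, b], ![c, d], m) (![a, b - t * d], ![c + t * a, d], m) := by
  convert SameOrbit.transvection (e := (![0, 1], 0, 0)) (x := (0, ![t, 0], 0)) (q := 0)
    (addTwoPlanes_symm hB) (by simp) (by simp) (by simp) (![a, b], ![c, d], m) using 1
  simp [transvection_apply, mul_comm]

theorem sameOrbit_f₁_f₂ {B : Bil M} (hB : IsSymmForm B) (t a b c d : ℤ) (m : M) :
    SameOrbit (addTwoPlanes B) (![a, b], ![c, d], m) (![a, b - t * c], ![c, d + t * a], m) := by
  convert SameOrbit.transvection (e := (![0, 1], 0, 0)) (x := (0, ![0, t], 0)) (q := 0)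
    (addTwoPlanes_symm hB) (by simp) (by simp) (by simp) (![a, b], ![c, d], m) using 1
  simp [transvection_apply, mul_comm]

theorem sameOrbit_e₂ {B : Bil M} (hB : IsSymmForm B) {x : M} {q : ℤ} (hx : B x x = 2 * q)
    (a b c d : ℤ) (m : M) :
    SameOrbit (addTwoPlanes B) (![a, b], ![c, d], m)
      (![a, b], ![c - B x m - q * d, d], m + d • x) := by
  convert SameOrbit.transvection (e := (0, ![1, 0], 0)) (x := (0, 0, x)) (q := q)
    (addTwoPlanes_symm hB) (by simp) (by simp) (by simpa using hx) (![a, b], ![c, d], m) using 1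
  simp [transvection_apply]

theorem sameOrbit_f₁ {B : Bil M} (hB : IsSymmForm B) {x : M} {q : ℤ} (hx : B x x = 2 * q)
    (a b c d : ℤ) (m : M) :
    SameOrbit (addTwoPlanes B) (![a, b], ![c, d], m)
      (![a, b - B x m - q * a], ![c, d], m + a • x) := by
  convert SameOrbit.transvection (e := (![0, 1], 0, 0)) (x := (0, 0, x)) (q := q)
    (addTwoPlanes_symm hB) (by simp) (by simp) (by simpa using hx) (![a, b], ![c, d], m) using 1
  simp [transvection_apply]

theorem vec_ext (x : Fin 2 → ℤ) : ![x 0, x 1] = x := by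
  ext i; fin_cases i <;> rfl

/-- Every vector with a nonzero product has in its orbit a vector with nonzero first coordinate. -/
theorem exists_sameOrbit_fst_ne_zero {B : Bil M} (hB : IsSymmForm B) (hev : IsEvenForm B)
    (a b c d : ℤ) (m : M) (hne : a = 0 → b = 0 → c = 0 → d = 0 → ∃ x, B x m ≠ 0) :
    ∃ a' b' c' d' m', a' ≠ 0 ∧
      SameOrbit (addTwoPlanes B) (![a, b], ![c, d], m) (![a', b'], ![c', d'], m') := by
  by_cases ha : a = 0
  swap
  · exact ⟨a, b, c, d, m, ha, .refl _ _⟩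
  have of_c : ∀ b c d m, c ≠ 0 → ∃ a' b' c' d' m', a' ≠ 0 ∧
      SameOrbit (addTwoPlanes B) (![0, b], ![c, d], m) (![a', b'], ![c', d'], m') :=
    fun b c d m hc => ⟨_, _, _, _, _, by simpa using hc, sameOrbit_e₁_f₂ hB 1 0 b c d m⟩
  subst ha
  by_cases hc : c = 0
  swap
  · exact of_c b c d m hc
  by_cases hd : d = 0
  swap
  · exact ⟨_, _, _, _, _, by simpa using hd, sameOrbit_e₁_e₂ hB 1 0 b c d m⟩
  subst hc hd
  by_cases hb : b = 0
  swap
  · obtain ⟨a', b', c', d', m', ha', h⟩ := of_c b b 0 m hb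
    refine ⟨a', b', c', d', m', ha', .trans ?_ h⟩
    simpa using sameOrbit_e₁_e₂ hB 1 0 b 0 0 m
  obtain ⟨x, hx⟩ := hne rfl hb rfl rfl
  obtain ⟨q, hq⟩ := hev x
  obtain ⟨a', b', c', d', m', ha', h⟩ := of_c b (-B x m) 0 m (neg_ne_zero.mpr hx)
  refine ⟨a', b', c', d', m', ha', .trans ?_ h⟩
  simpa using sameOrbit_e₂ hB hq 0 b 0 0 m

theorem exists_mul_sub_natAbs_lt {a c : ℤ} (ha : a ≠ 0) (h : ¬ a ∣ c) :
    ∃ s t : ℤ, a - t * (c + s * a) ≠ 0 ∧ (a - t * (c + s * a)).natAbs < a.natAbs := by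
  have hr : 0 < c % a := lt_of_le_of_ne (Int.emod_nonneg c ha)
    fun h0 => h (Int.dvd_of_emod_eq_zero h0.symm)
  have hlt : c % a < a.natAbs := Int.abs_eq_natAbs a ▸ Int.emod_lt_abs c ha
  have hc : c + -(c / a) * a = c % a := by
    have := Int.emod_add_mul_ediv c a
    linarith
  refine ⟨-(c / a), (a - 1) / (c % a), ?_⟩
  rw [hc]
  generalize c % a = r at hr hlt
  have hmod := Int.emod_add_mul_ediv (a - 1) r
  have h0 := Int.emod_nonneg (a - 1) hr.ne'
  have h1 := Int.emod_lt_of_pos (a - 1) hr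
  have : a - (a - 1) / r * r = (a - 1) % r + 1 := by linarith
  rw [this]
  omega

/-- A nonzero first coordinate of minimal absolute value in the orbit divides all products. -/
theorem exists_sameOrbit_fst_dvd {B : Bil M} (hB : IsSymmForm B) (hev : IsEvenForm B)
    (v : (Fin 2 → ℤ) × (Fin 2 → ℤ) × M) (hne : ∃ w, addTwoPlanes B v w ≠ 0) :
    ∃ a b m, SameOrbit (addTwoPlanes B) v (![a, b], ![0, 0], m) ∧ a ∣ b ∧ ∀ x, a ∣ B x m := by
  classical
  let P : ℕ → Prop := fun n => ∃ a b c d m, a ≠ 0 ∧ a.natAbs = n ∧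
    SameOrbit (addTwoPlanes B) v (![a, b], ![c, d], m)
  have hP : ∃ n, P n := by
    obtain ⟨x, y, m⟩ := v
    obtain ⟨w, hw⟩ := hne
    obtain ⟨a, b, c, d, m', ha, h⟩ :=
      exists_sameOrbit_fst_ne_zero hB hev (x 0) (x 1) (y 0) (y 1) m fun h₁ h₂ h₃ h₄ =>
        ⟨w.2.2, by simpa [h₁, h₂, h₃, h₄, hB m] using hw⟩
    rw [vec_ext, vec_ext] at h
    exact ⟨_, a, b, c, d, m', ha, rfl, h⟩
  obtain ⟨a, b₀, c₀, d₀, m, ha, han, horb⟩ := Nat.find_spec hP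
  have hmin : ∀ a' b' c' d' m', a' ≠ 0 →
      SameOrbit (addTwoPlanes B) v (![a', b'], ![c', d'], m') → a.natAbs ≤ a'.natAbs :=
    fun a' b' c' d' m' h h' => han ▸ Nat.find_min' hP ⟨a', b', c', d', m', h, rfl, h'⟩
  have hc : ∀ b c d m, SameOrbit (addTwoPlanes B) v (![a, b], ![c, d], m) → a ∣ c := by
    intro b c d m h
    by_contra hdvd
    obtain ⟨s, t, h₀, hlt⟩ := exists_mul_sub_natAbs_lt ha hdvd
    exact hlt.not_ge (hmin _ _ _ _ _ h₀
      ((h.trans (sameOrbit_f₁_e₂ hB s _ _ _ _ _)).trans (sameOrbit_e₁_f₂ hB t _ _ _ _ _)))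
  have hd : ∀ b c d m, SameOrbit (addTwoPlanes B) v (![a, b], ![c, d], m) → a ∣ d := by
    intro b c d m h
    by_contra hdvd
    obtain ⟨s, t, h₀, hlt⟩ := exists_mul_sub_natAbs_lt ha hdvd
    exact hlt.not_ge (hmin _ _ _ _ _ h₀
      ((h.trans (sameOrbit_f₁_f₂ hB s _ _ _ _ _)).trans (sameOrbit_e₁_e₂ hB t _ _ _ _ _)))
  obtain ⟨s, rfl⟩ := hc _ _ _ _ horb
  obtain ⟨t, rfl⟩ := hd _ _ _ _ horb
  have h := (horb.trans (sameOrbit_f₁_e₂ hB (-s) _ _ _ _ _)).trans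
    (sameOrbit_f₁_f₂ hB (-t) _ _ _ _ _)
  rw [show a * s + -s * a = 0 by ring, show a * t + -t * a = 0 by ring] at h
  refine ⟨a, _, m, h, ?_, fun x => ?_⟩
  · have h' := h.trans (sameOrbit_e₁_e₂ hB 1 _ _ _ _ _)
    rw [mul_zero, sub_zero, zero_add, one_mul] at h'
    exact hc _ _ _ _ h'
  · obtain ⟨q, hq⟩ := hev x
    simpa using hc _ _ _ _ (h.trans (sameOrbit_e₂ hB hq _ _ _ _ _))

/-- Eichler's criterion: isotropic vectors of divisibility one in a lattice containing two
hyperbolic planes form a single orbit. -/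
theorem sameOrbit_standard {B : Bil M} (hB : IsSymmForm B) (hev : IsEvenForm B)
    {v : (Fin 2 → ℤ) × (Fin 2 → ℤ) × M} (hv : addTwoPlanes B v v = 0)
    (hdiv : ∃ w, addTwoPlanes B v w = 1) :
    SameOrbit (addTwoPlanes B) v (![1, 0], 0, 0) := by
  obtain ⟨w, hw⟩ := hdiv
  obtain ⟨a, b, m, h, hab, ham⟩ := exists_sameOrbit_fst_dvd hB hev v ⟨w, by simp [hw]⟩
  have ha : a = 1 ∨ a = -1 := by
    obtain ⟨φ, hφ, hφv⟩ := h
    rw [← hφ, hφv] at hw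
    refine Int.isUnit_iff.mp (isUnit_of_dvd_one ?_)
    rw [← hw]
    simp only [prodForm_apply, HForm_apply, hB m]
    exact dvd_add (dvd_add (dvd_mul_right a _) (dvd_mul_of_dvd_left hab _))
      (dvd_add (by simp) (ham _))
  obtain ⟨b, m, h⟩ : ∃ b m, SameOrbit (addTwoPlanes B) v (![1, b], ![0, 0], m) := by
    rcases ha with rfl | rfl
    · exact ⟨b, m, h⟩
    · exact ⟨-b, -m, by simpa using h.trans (.neg _ _)⟩
  obtain ⟨q, hq⟩ := hev (-m)
  have h' := h.trans (sameOrbit_f₁ hB hq _ _ _ _ _)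
  generalize b - B (-m) m - q * 1 = b' at h'
  rw [one_smul, add_neg_cancel] at h'
  obtain ⟨φ, hφ, hφv⟩ := h'
  have hb : b' = 0 := by
    have := hφ v v
    rw [hv, hφv] at this
    simp at this
    omega
  subst hb
  exact ⟨φ, hφ, hφv.trans (by simp)⟩

end Eichler

/-- A primitive rank-two isotropic sublattice of the K3 lattice is carried by an isometry to the
span of the first basis vectors of the first two hyperbolic planes. -/
theorem exists_isometry_standard (I : Submodule ℤ K3type) (hIprim : PrimSub I)
    (hIiso : IsotropicSub K3Form I) (hIrk : Module.finrank ℤ ↥I = 2) :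
    ∃ φ : K3type ≃ₗ[ℤ] K3type, (∀ x y, K3Form (φ x) (φ y) = K3Form x y) ∧
      ∀ x, x ∈ I ↔ ∃ s t : ℤ, φ x = (![s, 0], ![t, 0], 0) := by
  have hEE_symm := E8Form_symm.prod E8Form_symm
  have hEE_even := E8Form_even.prod E8Form_even
  have hEE_unimod := E8Form_unimodular.prod E8Form_unimodular
  let b := Module.finBasisOfFinrankEq ℤ I hIrk
  have hspan : ∀ x : I, x = b.repr x 0 • b 0 + b.repr x 1 • b 1 := fun x => by
    rw [← Fin.sum_univ_two fun i => b.repr x i • b i, b.sum_repr]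
  have hprim : ∀ (v : I) (i : Fin 2), b.repr v i = 1 → PrimElt (v : K3type) := by
    intro v i hv n x hx
    have hn : n ≠ 0 := by
      rintro rfl
      have : v = 0 := Subtype.ext (by simpa using hx)
      simp [this] at hv
    have hxI : x ∈ I := hIprim n x hn (hx ▸ v.2)
    have : v = n • ⟨x, hxI⟩ := Subtype.ext hx
    rw [this, map_smul, Finsupp.smul_apply, smul_eq_mul] at hv
    exact IsUnit.of_mul_eq_one _ hv
  obtain ⟨φ₁, hφ₁, hφ₁v⟩ := sameOrbit_standard (HForm_symm.prod hEE_symm)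
    (HForm_even.prod hEE_even) (v := (b 0 : K3type)) (hIiso _ (b 0).2 _ (b 0).2)
    ((HForm_unimodular.prod (HForm_unimodular.prod (HForm_unimodular.prod
      hEE_unimod))).exists_eq_one (hprim (b 0) 0 (by simp)))
  let v₂ : I := b 1 - (φ₁ (b 1)).1 0 • b 0
  have hv₂_repr : b.repr v₂ 1 = 1 := by simp [v₂]
  have hφ₁v₂ : φ₁ v₂ = (0, (φ₁ v₂).2) := by
    have horth : addTwoPlanes _ (φ₁ (b 0)) (φ₁ (b 1)) = 0 :=
      (hφ₁ _ _).trans (hIiso _ (b 0).2 _ (b 1).2)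
    rw [hφ₁v] at horth
    have hv₂ : φ₁ v₂ = φ₁ (b 1) - (φ₁ (b 1)).1 0 • (![1, 0], 0, 0) := by
      rw [← hφ₁v, ← map_smul, ← map_sub]
      rfl
    refine Prod.ext (funext fun i => ?_) rfl
    rw [hv₂]
    fin_cases i
    · simp
    · simpa using horth
  set w := (φ₁ v₂).2
  have hw_prim : PrimElt w := by
    intro n u hu
    refine hprim v₂ 1 hv₂_repr n (φ₁.symm (0, u)) ?_
    rw [← map_smul, LinearEquiv.eq_symm_apply, hφ₁v₂, hu]
    simp
  have hw_iso : addTwoPlanes (prodForm E8Form E8Form) w w = 0 := by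
    have h0 : addTwoPlanes _ (φ₁ v₂) (φ₁ v₂) = 0 := (hφ₁ _ _).trans (hIiso _ v₂.2 _ v₂.2)
    rw [hφ₁v₂] at h0
    simpa using h0
  obtain ⟨ψ, hψ, hψw⟩ := sameOrbit_standard hEE_symm hEE_even hw_iso
    ((HForm_unimodular.prod (HForm_unimodular.prod hEE_unimod)).exists_eq_one hw_prim)
  let Ψ : K3type ≃ₗ[ℤ] K3type := (LinearEquiv.refl ℤ (Fin 2 → ℤ)).prodCongr ψ
  have h₁ : (φ₁.trans Ψ) (b 0) = (![1, 0], 0, 0) := by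
    rw [LinearEquiv.trans_apply, hφ₁v]
    exact Prod.ext rfl (map_zero ψ)
  have h₂ : (φ₁.trans Ψ) v₂ = (0, ![1, 0], 0) := by
    rw [LinearEquiv.trans_apply, hφ₁v₂]
    simp [Ψ, hψw]
  refine ⟨φ₁.trans Ψ, fun x y => ?_, fun x => ⟨fun hx => ?_, ?_⟩⟩
  · refine Eq.trans ?_ (hφ₁ x y)
    change HForm _ _ + addTwoPlanes _ (ψ _) (ψ _) = _
    rw [hψ]
    rfl
  · have hx' := hspan ⟨x, hx⟩
    generalize b.repr ⟨x, hx⟩ 0 = s at hx'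
    generalize b.repr ⟨x, hx⟩ 1 = t at hx'
    have hx'' : x = (s + t * (φ₁ (b 1)).1 0) • (b 0 : K3type) + t • (v₂ : K3type) := by
      rw [show x = s • (b 0 : K3type) + t • (b 1 : K3type) from congrArg Subtype.val hx']
      simp only [v₂, Submodule.coe_sub, Submodule.coe_smul]
      module
    refine ⟨s + t * (φ₁ (b 1)).1 0, t, ?_⟩
    rw [hx'', map_add, map_smul, map_smul, h₁, h₂]
    simp
  · rintro ⟨s, t, h⟩
    have : x = s • (b 0 : K3type) + t • (v₂ : K3type) := by
      apply (φ₁.trans Ψ).injective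
      rw [h, map_add, map_smul, map_smul, h₁, h₂]
      simp
    rw [this]
    exact I.add_mem (I.smul_mem _ (b 0).2) (I.smul_mem _ v₂.2)

end DF

open DF in
/-- Let `I` be a primitive rank-2 isotropic sublattice of the
K3 lattice `Λ_K3`. Then the quotient lattice `I^⊥/I`, with the form induced
from `Λ_K3`, is isometric to `H ⊕ E₈ ⊕ E₈`. -/
theorem stmt19 (I : Submodule ℤ K3type) (hIprim : PrimSub I)
    (hIiso : IsotropicSub K3Form I) (hIrk : Module.finrank ℤ ↥I = 2) :
    ∃ e : HEEtype ≃ₗ[ℤ]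
        (↥(perpSub K3Form I) ⧸ Submodule.comap (perpSub K3Form I).subtype I),
      ∀ (u v : HEEtype) (x y : ↥(perpSub K3Form I)),
        e u = Submodule.Quotient.mk x → e v = Submodule.Quotient.mk y →
        K3Form (x : K3type) (y : K3type) = HEEForm u v := by
  obtain ⟨φ, hφ, hI⟩ := exists_isometry_standard I hIprim hIiso hIrk
  have hB : IsSymmForm K3Form := HForm_symm.prod (HForm_symm.prod (HForm_symm.prod
    (E8Form_symm.prod E8Form_symm)))
  have hmem : ∀ u : HEEtype, φ.symm (0, 0, u) ∈ perpSub K3Form I := by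
    intro u s hs
    obtain ⟨a, b, hs⟩ := (hI s).mp hs
    have : K3Form s (φ.symm (0, 0, u)) = 0 := by
      rw [← hφ, LinearEquiv.apply_symm_apply, hs]
      simp [K3Form]
    exact ⟨this, by rw [hB, this]⟩
  have hperp : ∀ x ∈ perpSub K3Form I, (φ x).1 1 = 0 ∧ (φ x).2.1 1 = 0 := by
    intro x hx
    have key : ∀ a b : ℤ, K3Form (![a, 0], ![b, 0], 0) (φ x) = 0 := fun a b => by
      rw [← φ.apply_symm_apply (![a, 0], ![b, 0], 0), hφ]
      exact (hx _ ((hI _).mpr ⟨a, b, φ.apply_symm_apply _⟩)).1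
    exact ⟨by simpa [K3Form] using key 1 0, by simpa [K3Form] using key 0 1⟩
  let T : HEEtype →ₗ[ℤ] ↥(perpSub K3Form I) :=
    (φ.symm.toLinearMap ∘ₗ LinearMap.inr ℤ _ _ ∘ₗ LinearMap.inr ℤ _ _).codRestrict _ hmem
  have hT : ∀ u, φ (T u) = (0, 0, u) := fun u => φ.apply_symm_apply _
  let F := (Submodule.comap (perpSub K3Form I).subtype I).mkQ ∘ₗ T
  have hF : ∀ u (x : ↥(perpSub K3Form I)), F u = Submodule.Quotient.mk x ↔
      ∃ s t : ℤ, φ x = (![s, 0], ![t, 0], u) := by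
    intro u x
    rw [eq_comm]
    refine (Submodule.Quotient.eq _).trans ((hI _).trans ?_)
    simp only [Submodule.subtype_apply, map_sub, hT, sub_eq_iff_eq_add,
      Prod.mk_add_mk, add_zero, zero_add]
  have hbij : Function.Bijective F := by
    refine ⟨(injective_iff_map_eq_zero F).mpr fun u hu => ?_, fun y => ?_⟩
    · obtain ⟨s, t, h⟩ := (hF u 0).mp hu
      simpa using (congrArg (fun z => z.2.2) h).symm
    · obtain ⟨x, rfl⟩ := Submodule.Quotient.mk_surjective _ y
      obtain ⟨h₁, h₂⟩ := hperp x x.2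
      refine ⟨(φ x).2.2, (hF _ x).mpr ⟨(φ x).1 0, (φ x).2.1 0, ?_⟩⟩
      refine Prod.ext ?_ (Prod.ext ?_ rfl)
      · rw [← h₁, vec_ext]
      · rw [← h₂, vec_ext]
  refine ⟨LinearEquiv.ofBijective F hbij, fun u v x y hu hv => ?_⟩
  obtain ⟨s, t, hx⟩ := (hF u x).mp hu
  obtain ⟨s', t', hy⟩ := (hF v y).mp hv
  rw [← hφ, hx, hy]
  simp [K3Form, HEEForm]
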